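/- arXiv:2005.04533 — 2 statements merged into one kernel-verified Lean document; each statement's English description precedes it below -/
import Mathlib

section
/- Let X_1, ..., X_k be independent real random variables with 0 \le X_i \le c almost surely for a fixed constant c > 0, and suppose E[\sum_{i=1}^k X_i] \le c. Then for every natural number m \ge 9 and every real b > 1, P[\sum_{i=1}^k X_i > (3 b \ln m / \ln \ln m) \cdot c] \le exp(-1.5 b \ln m - 3 b (\ln b) (\ln m / \ln \ln m) - 1). -/
open MeasureTheory ProbabilityTheory

/-- The chord bound for `exp` on `[0, c]`. -/
lemma exp_mul_le_one_add_div_mul {c t x : ℝ} (hc : 0 < c) (hx : x ∈ Set.Icc 0 c) :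
    Real.exp (t * x) ≤ 1 + x * ((Real.exp (t * c) - 1) / c) := by
  have h1 : 0 ≤ x / c := div_nonneg hx.1 hc.le
  have h2 : 0 ≤ 1 - x / c := sub_nonneg.2 ((div_le_one hc).2 hx.2)
  have h := convexOn_exp.2 (Set.mem_univ 0) (Set.mem_univ (t * c)) h2 h1 (by ring)
  have e : (1 - x / c) • (0 : ℝ) + (x / c) • (t * c) = t * x := by
    simp only [smul_eq_mul]
    field_simp
    ring
  rw [e] at h
  refine h.trans (le_of_eq ?_)
  simp only [smul_eq_mul, Real.exp_zero]
  ring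

section

variable {Ω : Type*} [MeasurableSpace Ω] {μ : Measure Ω} [IsProbabilityMeasure μ] {c : ℝ}

lemma mgf_le_exp_integral_mul {X : Ω → ℝ} (hc : 0 < c) (hX : AEMeasurable X μ)
    (hXval : ∀ᵐ ω ∂μ, X ω ∈ Set.Icc 0 c) (t : ℝ) :
    mgf X μ t ≤ Real.exp ((∫ ω, X ω ∂μ) * ((Real.exp (t * c) - 1) / c)) := by
  have hint : Integrable X μ := Integrable.of_mem_Icc 0 c hX hXval
  have hint' := hint.mul_const ((Real.exp (t * c) - 1) / c)
  calc mgf X μ t ≤ ∫ ω, (1 + X ω * ((Real.exp (t * c) - 1) / c)) ∂μ :=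
        integral_mono_of_nonneg (Filter.Eventually.of_forall fun _ => (Real.exp_pos _).le)
          ((integrable_const _).add hint')
          (hXval.mono fun _ h => exp_mul_le_one_add_div_mul hc h)
    _ = (∫ ω, X ω ∂μ) * ((Real.exp (t * c) - 1) / c) + 1 := by
        rw [integral_add (integrable_const _) hint', integral_mul_const]
        simp [add_comm]
    _ ≤ _ := Real.add_one_le_exp _

/-- Chernoff's bound for a sum of independent `[0, c]`-valued variables with mean at most `c`. -/
lemma measureReal_mul_le_sum_le_exp {ι : Type*} [Fintype ι] {X : ι → Ω → ℝ} (hc : 0 < c)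
    (hX : ∀ i, Measurable (X i)) (hXind : iIndepFun X μ)
    (hXval : ∀ i, ∀ᵐ ω ∂μ, X i ω ∈ Set.Icc 0 c) (hXexp : (∫ ω, (∑ i, X i ω) ∂μ) ≤ c)
    {a : ℝ} (ha : 1 ≤ a) :
    μ.real {ω | a * c ≤ ∑ i, X i ω} ≤ Real.exp (a - 1 - a * Real.log a) := by
  have ha0 : 0 < a := by linarith
  have ht : 0 ≤ Real.log a / c := div_nonneg (Real.log_nonneg ha) hc.le
  have htc : Real.log a / c * c = Real.log a := div_mul_cancel₀ _ hc.ne'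
  have hint (i) : Integrable (X i) μ := Integrable.of_mem_Icc 0 c (hX i).aemeasurable (hXval i)
  have hmgf : mgf (∑ i, X i) μ (Real.log a / c) ≤ Real.exp (a - 1) := by
    rw [hXind.mgf_sum hX]
    calc ∏ i, mgf (X i) μ (Real.log a / c)
        ≤ ∏ i, Real.exp ((∫ ω, X i ω ∂μ) * ((a - 1) / c)) := by
          refine Finset.prod_le_prod (fun _ _ => mgf_nonneg) fun i _ => ?_
          simpa [htc, Real.exp_log ha0] using
            mgf_le_exp_integral_mul hc (hX i).aemeasurable (hXval i) (Real.log a / c)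
      _ = Real.exp ((∫ ω, (∑ i, X i ω) ∂μ) * ((a - 1) / c)) := by
          rw [← Real.exp_sum, ← Finset.sum_mul, integral_finsetSum _ fun i _ => hint i]
      _ ≤ Real.exp (c * ((a - 1) / c)) := by
          have : 0 ≤ (a - 1) / c := div_nonneg (by linarith) hc.le
          gcongr
      _ = Real.exp (a - 1) := by rw [mul_div_cancel₀ _ hc.ne']
  have hexp : Integrable (fun ω => Real.exp (Real.log a / c * (∑ i, X i) ω)) μ := by
    refine hXind.integrable_exp_mul_sum hX fun i _ => ?_
    exact integrable_exp_mul_of_mem_Icc (hX i).aemeasurable (hXval i)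
  have h := measure_ge_le_exp_mul_mgf (a * c) ht hexp
  simp only [Finset.sum_apply] at h
  refine h.trans ((mul_le_mul_of_nonneg_left hmgf (Real.exp_pos _).le).trans (le_of_eq ?_))
  rw [← Real.exp_add]
  congr 1
  linear_combination -a * htc

end

/-- The Chernoff exponent at `3 b L / log L` dominates the claimed one. -/
lemma chernoff_exponent_le {L b : ℝ} (hL : 1 < L) (hb : 0 < b) :
    let a := 3 * b * L / Real.log L
    a - 1 - a * Real.log a
      ≤ -(1.5 * b * L) - 3 * b * Real.log b * (L / Real.log L) - 1 := by
  intro a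
  have hl : 0 < Real.log L := Real.log_pos hL
  have hL0 : 0 < L := by linarith
  have ha : 0 < a := by positivity
  have hlog : Real.log a = Real.log 3 + Real.log b + Real.log L - Real.log (Real.log L) := by
    rw [Real.log_div (by positivity) hl.ne', Real.log_mul (by positivity) hL0.ne',
      Real.log_mul (by norm_num) hb.ne']
  have hloglog : Real.log (Real.log L) ≤ Real.log L / 2 + Real.log 3 - 1 := by
    have h1 := Real.log_le_sub_one_of_pos (half_pos hl)
    rw [Real.log_div hl.ne' two_ne_zero] at h1
    have h2 : Real.log 2 ≤ Real.log 3 := Real.log_le_log (by norm_num) (by norm_num)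
    linarith
  have hal : a * Real.log L = 3 * b * L := div_mul_cancel₀ _ hl.ne'
  have hab : 3 * b * Real.log b * (L / Real.log L) = a * Real.log b := by
    simp only [a]; ring
  rw [hlog, hab]
  have := mul_le_mul_of_nonneg_left hloglog ha.le
  linarith

/-- Let `X 1, ..., X k` be independent real random variables with `0 ≤ X i ≤ c` almost surely
for a fixed constant `c > 0`, and suppose `E[∑ i, X i] ≤ c`.  Then for every natural `m ≥ 9` and
every real `b > 1`,
`P[∑ i, X i > (3 b ln m / ln ln m) * c] ≤ exp (-1.5 b ln m - 3 b (ln b) (ln m / ln ln m) - 1)`. -/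
theorem overflow_probability_single_edge
    {Ω : Type*} [MeasureSpace Ω] [IsProbabilityMeasure (ℙ : Measure Ω)]
    (k : ℕ) (X : Fin k → Ω → ℝ) (c : ℝ) (hc : 0 < c)
    (hXmeas : ∀ i, Measurable (X i))
    (hXind : iIndepFun X ℙ)
    (hXval : ∀ i, ∀ᵐ ω ∂ℙ, X i ω ∈ Set.Icc (0 : ℝ) c)
    (hXexp : (∫ ω, (∑ i, X i ω) ∂ℙ) ≤ c) :
    ∀ m : ℕ, 9 ≤ m → ∀ b : ℝ, 1 < b →
      ℙ {ω | (∑ i, X i ω) > (3 * b * Real.log m / Real.log (Real.log m)) * c}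
        ≤ ENNReal.ofReal (Real.exp (-(1.5 * b * Real.log m)
            - 3 * b * Real.log b * (Real.log m / Real.log (Real.log m)) - 1)) := by
  intro m hm b hb
  have hL : 1 < Real.log m := by
    rw [Real.lt_log_iff_exp_lt (by positivity)]
    have : (9 : ℝ) ≤ m := by exact_mod_cast hm
    linarith [Real.exp_one_lt_d9]
  have hl : 0 < Real.log (Real.log m) := Real.log_pos hL
  have hb0 : 0 < b := by linarith
  have ha : 1 ≤ 3 * b * Real.log m / Real.log (Real.log m) := by
    rw [one_le_div hl]
    have := Real.log_le_sub_one_of_pos (zero_lt_one.trans hL)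
    nlinarith
  have hsub : {ω | (∑ i, X i ω) > 3 * b * Real.log m / Real.log (Real.log m) * c} ⊆
      {ω | 3 * b * Real.log m / Real.log (Real.log m) * c ≤ ∑ i, X i ω} :=
    Set.ofPred_subset_ofPred.2 fun _ h => h.le
  refine (measure_mono hsub).trans ?_
  rw [← ofReal_measureReal]
  exact ENNReal.ofReal_le_ofReal
    ((measureReal_mul_le_sum_le_exp hc hXmeas hXind hXval hXexp ha).trans
      (Real.exp_le_exp.2 (chernoff_exponent_le hL hb0)))
end

section
/- Let E be a finite set of m \ge 9 edges with capacities c(e) > 0 for each e \in E. Suppose that for each e \in E there are random variables X_{e,1}, ..., X_{e,k} on a common probability space such that, for each fixed e, the family (X_{e,i})_{i=1}^k is independent, 0 \le X_{e,i} \le c(e) almost surely, and E[\sum_{i=1}^k X_{e,i}] \le c(e). Then for every real b > 1, the probability that there exists some e \in E with \sum_{i=1}^k X_{e,i} > (3 b \ln m / \ln \ln m) \cdot c(e) is at most exp(-(1.5 b - 1) \ln m - 3 b (\ln b) (\ln m / \ln \ln m) - 1). -/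
open MeasureTheory ProbabilityTheory

lemma exp_mul_le_one_add_mul (t y : ℝ) (hy : y ∈ Set.Icc (0 : ℝ) 1) :
    Real.exp (t * y) ≤ 1 + (Real.exp t - 1) * y := by
  have h := convexOn_exp.2 (Set.mem_univ 0) (Set.mem_univ t) (sub_nonneg.2 hy.2) hy.1
    (sub_add_cancel 1 y)
  simp only [smul_eq_mul, mul_zero, zero_add, Real.exp_zero, mul_one] at h
  rw [mul_comm t y]
  linarith

/-- The moment generating function of a `[0, c]`-valued random variable, at `t / c`. -/
lemma mgf_div_le_exp {Ω : Type*} [MeasurableSpace Ω] {μ : Measure Ω} [IsProbabilityMeasure μ]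
    {c : ℝ} (hc : 0 < c) {X : Ω → ℝ} (hX : Measurable X)
    (hval : ∀ᵐ ω ∂μ, X ω ∈ Set.Icc (0 : ℝ) c) (t : ℝ) :
    mgf X μ (t / c) ≤ Real.exp ((Real.exp t - 1) / c * ∫ ω, X ω ∂μ) := by
  have hintegrable : Integrable X μ := Integrable.of_mem_Icc 0 c hX.aemeasurable hval
  have hle : mgf X μ (t / c) ≤ ∫ ω, (1 + (Real.exp t - 1) / c * X ω) ∂μ := by
    refine integral_mono_of_nonneg (Filter.Eventually.of_forall fun ω => (Real.exp_pos _).le)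
      ((integrable_const _).add (hintegrable.const_mul _)) ?_
    filter_upwards [hval] with ω hω
    have h := exp_mul_le_one_add_mul t (X ω / c)
      ⟨div_nonneg hω.1 hc.le, (div_le_one hc).2 hω.2⟩
    calc Real.exp (t / c * X ω) = Real.exp (t * (X ω / c)) := by congr 1; ring
      _ ≤ 1 + (Real.exp t - 1) * (X ω / c) := h
      _ = 1 + (Real.exp t - 1) / c * X ω := by ring
  rw [integral_add (integrable_const _) (hintegrable.const_mul _), integral_const_mul] at hle
  simp only [integral_const, probReal_univ, smul_eq_mul, mul_one] at hle
  linarith [Real.add_one_le_exp ((Real.exp t - 1) / c * ∫ ω, X ω ∂μ)]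

/-- Chernoff bound for a sum of independent `[0, c]`-valued random variables of total mean at
most `c`. -/
lemma measureReal_sum_ge_le_exp {Ω : Type*} [MeasurableSpace Ω] {μ : Measure Ω}
    [IsProbabilityMeasure μ] {ι : Type*} [Fintype ι] {c : ℝ} (hc : 0 < c) {X : ι → Ω → ℝ}
    (hX : ∀ i, Measurable (X i)) (hind : iIndepFun X μ)
    (hval : ∀ i, ∀ᵐ ω ∂μ, X i ω ∈ Set.Icc (0 : ℝ) c)
    (hmean : (∫ ω, (∑ i, X i ω) ∂μ) ≤ c) {t : ℝ} (ht : 0 ≤ t) (a : ℝ) :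
    μ.real {ω | a * c ≤ ∑ i, X i ω} ≤ Real.exp (Real.exp t - 1 - t * a) := by
  have hintegrable : ∀ i, Integrable (X i) μ := fun i =>
    Integrable.of_mem_Icc 0 c (hX i).aemeasurable (hval i)
  have hbound : ∀ᵐ ω ∂μ, ∀ i, X i ω ∈ Set.Icc (0 : ℝ) c := ae_all_iff.2 hval
  have hexp : Integrable (fun ω => Real.exp (t / c * (∑ i, X i) ω)) μ := by
    refine Integrable.of_mem_Icc 0 (Real.exp (t / c * ∑ _i : ι, c)) ?_ ?_
    · simp only [Finset.sum_apply]
      exact (((Finset.measurable_sum _ fun i _ => hX i).const_mul _).exp).aemeasurable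
    · filter_upwards [hbound] with ω hω
      refine ⟨(Real.exp_pos _).le, Real.exp_le_exp.2 ?_⟩
      rw [Finset.sum_apply]
      exact mul_le_mul_of_nonneg_left (Finset.sum_le_sum fun i _ => (hω i).2)
        (div_nonneg ht hc.le)
  have hmgf : mgf (∑ i, X i) μ (t / c) ≤ Real.exp (Real.exp t - 1) := by
    rw [hind.mgf_sum hX]
    calc ∏ i, mgf (X i) μ (t / c)
        ≤ ∏ i, Real.exp ((Real.exp t - 1) / c * ∫ ω, X i ω ∂μ) :=
          Finset.prod_le_prod (fun i _ => mgf_nonneg) fun i _ =>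
            mgf_div_le_exp hc (hX i) (hval i) t
      _ = Real.exp ((Real.exp t - 1) / c * ∫ ω, (∑ i, X i ω) ∂μ) := by
          rw [← Real.exp_sum, ← Finset.mul_sum, integral_finsetSum _ fun i _ => hintegrable i]
      _ ≤ Real.exp (Real.exp t - 1) := by
          refine Real.exp_le_exp.2 ?_
          have h0 : 0 ≤ Real.exp t - 1 := by linarith [Real.add_one_le_exp t]
          calc (Real.exp t - 1) / c * ∫ ω, (∑ i, X i ω) ∂μ
              ≤ (Real.exp t - 1) / c * c :=
                mul_le_mul_of_nonneg_left hmean (div_nonneg h0 hc.le)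
            _ = Real.exp t - 1 := div_mul_cancel₀ _ hc.ne'
  have h := measure_ge_le_exp_mul_mgf (a * c) (div_nonneg ht hc.le) hexp
  simp only [Finset.sum_apply] at h
  refine h.trans ?_
  calc Real.exp (-(t / c) * (a * c)) * mgf (∑ i, X i) μ (t / c)
      ≤ Real.exp (-(t / c) * (a * c)) * Real.exp (Real.exp t - 1) :=
        mul_le_mul_of_nonneg_left hmgf (Real.exp_pos _).le
    _ = Real.exp (Real.exp t - 1 - t * a) := by
        rw [← Real.exp_add]
        congr 1
        field_simp
        ring

lemma half_log_add_one_le_log_three_mul_div_log {L : ℝ} (hL : 1 < L) :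
    Real.log L / 2 + 1 ≤ Real.log (3 * (L / Real.log L)) := by
  have hl : 0 < Real.log L := Real.log_pos hL
  have hL0 : 0 < L := by linarith
  rw [Real.log_mul (by norm_num) (by positivity), Real.log_div hL0.ne' hl.ne']
  have h1 := Real.log_le_sub_one_of_pos (half_pos hl)
  rw [Real.log_div hl.ne' two_ne_zero] at h1
  have h2 : Real.log 2 ≤ Real.log 3 := Real.log_le_log (by norm_num) (by norm_num)
  linarith

lemma one_lt_log_of_nine_le {m : ℕ} (hm : 9 ≤ m) : 1 < Real.log m := by
  have h : (9 : ℝ) ≤ m := by exact_mod_cast hm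
  rw [Real.lt_log_iff_exp_lt (by linarith)]
  linarith [Real.exp_one_lt_d9]


/-- Union bound over all edges: if `E` is a finite set of `m ≥ 9` edges with capacities
`c e > 0`, and for each edge `e` the variables `X e 1, ..., X e k` are independent, lie in
`[0, c e]` almost surely, and satisfy `E[∑ i, X e i] ≤ c e`, then for every `b > 1` the
probability that some edge overflows by a factor of more than `3 b ln m / ln ln m` is at most
`exp (-(1.5 b - 1) ln m - 3 b (ln b) (ln m / ln ln m) - 1)`. -/
theorem overflow_probability_all_edges
    {Ω : Type*} [MeasureSpace Ω] [IsProbabilityMeasure (ℙ : Measure Ω)]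
    {E : Type*} [Fintype E] (m : ℕ) (hm : m = Fintype.card E) (hm9 : 9 ≤ m)
    (c : E → ℝ) (hc : ∀ e, 0 < c e)
    (k : ℕ) (X : E → Fin k → Ω → ℝ)
    (hXmeas : ∀ e i, Measurable (X e i))
    (hXind : ∀ e, iIndepFun (X e) ℙ)
    (hXval : ∀ e i, ∀ᵐ ω ∂ℙ, X e i ω ∈ Set.Icc (0 : ℝ) (c e))
    (hXexp : ∀ e, (∫ ω, (∑ i, X e i ω) ∂ℙ) ≤ c e) :
    ∀ b : ℝ, 1 < b →
      ℙ {ω | ∃ e : E, (∑ i, X e i ω) > (3 * b * Real.log m / Real.log (Real.log m)) * c e}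
        ≤ ENNReal.ofReal (Real.exp (-((1.5 * b - 1) * Real.log m)
            - 3 * b * Real.log b * (Real.log m / Real.log (Real.log m)) - 1)) := by
  intro b hb
  set L := Real.log m with hLdef
  have hL : 1 < L := one_lt_log_of_nine_le hm9
  have hm0 : (0 : ℝ) < m := by exact_mod_cast (by omega : 0 < m)
  have hl : 0 < Real.log L := Real.log_pos hL
  have hx : 0 < L / Real.log L := by positivity
  have hb0 : 0 < b := by linarith
  have hlog := half_log_add_one_le_log_three_mul_div_log hL
  obtain ⟨a, ha⟩ : ∃ a, a = 3 * b * L / Real.log L := ⟨_, rfl⟩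
  have ha' : a = b * (3 * (L / Real.log L)) := by rw [ha]; ring
  have ha0 : 0 < a := by rw [ha']; positivity
  have hloga : Real.log a = Real.log b + Real.log (3 * (L / Real.log L)) := by
    rw [ha', Real.log_mul hb0.ne' (by positivity)]
  have hloga0 : 0 ≤ Real.log a := by linarith [Real.log_pos hb]
  have hhalf : a * (Real.log L / 2) = 1.5 * b * L := by
    rw [ha]
    field_simp
    norm_num
  have hkey : L + (a - 1 - Real.log a * a) ≤
      -((1.5 * b - 1) * L) - 3 * b * Real.log b * (L / Real.log L) - 1 := by
    have h1 := mul_le_mul_of_nonneg_left hlog ha0.le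
    have h2 : 3 * b * Real.log b * (L / Real.log L) = a * Real.log b := by rw [ha']; ring
    rw [h2, hloga]
    linarith
  have hedge : ∀ e, ℙ {ω | (∑ i, X e i ω) > a * c e} ≤
      ENNReal.ofReal (Real.exp (a - 1 - Real.log a * a)) := by
    intro e
    have h := measureReal_sum_ge_le_exp (hc e) (hXmeas e) (hXind e) (hXval e) (hXexp e) hloga0 a
    rw [Real.exp_log ha0] at h
    have hsub : {ω | (∑ i, X e i ω) > a * c e} ⊆ {ω | a * c e ≤ ∑ i, X e i ω} :=
      fun ω (hω : a * c e < ∑ i, X e i ω) => hω.le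
    refine (measure_mono hsub).trans ?_
    exact (ENNReal.le_ofReal_iff_toReal_le (measure_ne_top _ _) (Real.exp_pos _).le).2 h
  rw [← ha, Set.ofPred_exists]
  calc ℙ (⋃ e, {ω | (∑ i, X e i ω) > a * c e})
      ≤ ∑ e, ℙ {ω | (∑ i, X e i ω) > a * c e} := measure_iUnion_fintype_le _ _
    _ ≤ ∑ _e : E, ENNReal.ofReal (Real.exp (a - 1 - Real.log a * a)) :=
        Finset.sum_le_sum fun e _ => hedge e
    _ = ENNReal.ofReal (Real.exp (L + (a - 1 - Real.log a * a))) := by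
        rw [Finset.sum_const, Finset.card_univ, ← hm, nsmul_eq_mul, Real.exp_add, hLdef,
          Real.exp_log hm0, ENNReal.ofReal_mul hm0.le, ENNReal.ofReal_natCast]
    _ ≤ _ := ENNReal.ofReal_le_ofReal (Real.exp_le_exp.2 hkey)
end
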